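/- Under the protocol, the maximum M(t) = max_i x_i(t) is nonincreasing in t, the minimum m(t) = min_i x_i(t) is nondecreasing in t, and the variance measure V2(t) = V2(x(t)) is nonincreasing in t. -/

import Mathlib

open scoped Classical

noncomputable section

/-- The rounding function `R` sending `x` to `1`, `0`, `-1` according to `x > 1`,
`-1 ≤ x ≤ 1`, `x < -1`. -/
def Rq (y : ℝ) : ℝ := if y > 1 then 1 else if y < -1 then -1 else 0

/-- The data and evolution equations of the ternary-message average-consensus protocol
on `n` nodes.  `E t i j` means the edge `(i,j)` is present in the graph `G(t)`
(for `t ≥ 1`); `x t i` is the value of node `i` at time `t`; `xin t i j` is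
`x̂_{i,j,in}(t)`, `xout t i j` is `x̂_{i,j,out}(t)` and `q t i j` is `q_{i→j}(t)`. -/
structure Protocol (n : ℕ) where
  α : ℝ
  β : ℝ
  hα : 0 < α
  hαβ : α < β
  hβ : β < 1
  E : ℕ → Fin n → Fin n → Prop
  Esymm : ∀ t i j, E t i j → E t j i
  Eirrefl : ∀ t i, ¬ E t i i
  D : Fin n → Fin n → ℕ → ℝ
  Dsymm : ∀ i j t, D i j t = D j i t
  Dbound : ∀ t i j, E t i j →
    ((max (Set.ncard {k | E t i k}) (Set.ncard {k | E t j k}) : ℕ) : ℝ) ≤ D i j t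
  x : ℕ → Fin n → ℝ
  xin : ℕ → Fin n → Fin n → ℝ
  xout : ℕ → Fin n → Fin n → ℝ
  q : ℕ → Fin n → Fin n → ℝ
  hxin0 : ∀ i j, xin 0 i j = 0
  hxout0 : ∀ i j, xout 0 i j = 0
  hq : ∀ t, 1 ≤ t → ∀ i j, E t i j →
    q t i j = Rq ((t : ℝ) ^ α * (x (t - 1) i - xout (t - 1) i j))
  hxoutE : ∀ t, 1 ≤ t → ∀ i j, E t i j →
    xout t i j = xout (t - 1) i j + q t i j / (t : ℝ) ^ α
  hxinE : ∀ t, 1 ≤ t → ∀ i j, E t i j →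
    xin t i j = xin (t - 1) i j + q t j i / (t : ℝ) ^ α
  hxoutN : ∀ t, 1 ≤ t → ∀ i j, ¬ E t i j → xout t i j = xout (t - 1) i j
  hxinN : ∀ t, 1 ≤ t → ∀ i j, ¬ E t i j → xin t i j = xin (t - 1) i j
  hx : ∀ t, 1 ≤ t → ∀ i, x t i = x (t - 1) i + (1 / (t : ℝ) ^ β) *
    ∑ j ∈ Finset.univ.filter (fun j => E t i j ∧
        4 / (t : ℝ) ^ α < |xin t i j - xout t i j| ∧ q t j i = 0 ∧ q t i j = 0),
      (xin t i j - xout t i j) / (4 * D i j t)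

namespace Protocol

variable {n : ℕ} (P : Protocol n)

/-- The set `S(i,t)` of neighbors that node `i` includes in its update at time `t`. -/
def S (t : ℕ) (i : Fin n) : Finset (Fin n) :=
  Finset.univ.filter (fun j => P.E t i j ∧
    4 / (t : ℝ) ^ P.α < |P.xin t i j - P.xout t i j| ∧ P.q t j i = 0 ∧ P.q t i j = 0)

/-- The graph sequence of the protocol is `B`-core-connected with core edge
relation `Einf`: every core edge appears at some time, the graph of core edges is
connected, and every core edge appears in every time window `[kB+1, (k+1)B]`. -/
def CoreConnected (B : ℕ) (Einf : Fin n → Fin n → Prop) : Prop :=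
  (∀ i j, Einf i j → ∃ t, 1 ≤ t ∧ P.E t i j) ∧
  (SimpleGraph.fromRel Einf).Connected ∧
  ∀ k : ℕ, ∀ i j, Einf i j → ∃ t, k * B + 1 ≤ t ∧ t ≤ (k + 1) * B ∧ P.E t i j

end Protocol

/-- `M(x)`: the largest coordinate. -/
def maxV {n : ℕ} (y : Fin n → ℝ) : ℝ := ⨆ i, y i

/-- `m(x)`: the smallest coordinate. -/
def minV {n : ℕ} (y : Fin n → ℝ) : ℝ := ⨅ i, y i

/-- `W(x) = M(x) - m(x)`. -/
def Wsp {n : ℕ} (y : Fin n → ℝ) : ℝ := maxV y - minV y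

/-- The sup norm `‖x‖_∞ = max_i |x_i|`. -/
def normInf {n : ℕ} (y : Fin n → ℝ) : ℝ := ⨆ i, |y i|

/-- `V2(x) = sqrt(Σ_i (x_i - (1/n) Σ_j x_j)²)`. -/
def V2 {n : ℕ} (y : Fin n → ℝ) : ℝ :=
  Real.sqrt (∑ i, (y i - (∑ j, y j) / n) ^ 2)

/-- `y` arises from `x` by averaging with symmetric nonnegative weights of row sums at most one. -/
def IsSymmAveraging {n : ℕ} (w : Fin n → Fin n → ℝ) (x y : Fin n → ℝ) : Prop :=
  (∀ i j, 0 ≤ w i j) ∧ (∀ i j, w i j = w j i) ∧ (∀ i, ∑ j, w i j ≤ 1) ∧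
    ∀ i, y i = x i + ∑ j, w i j * (x j - x i)

namespace IsSymmAveraging

variable {n : ℕ} {w : Fin n → Fin n → ℝ} {x y : Fin n → ℝ}

lemma neg (h : IsSymmAveraging w x y) : IsSymmAveraging w (-x) (-y) := by
  obtain ⟨h0, hs, h1, hy⟩ := h
  refine ⟨h0, hs, h1, fun i => ?_⟩
  simp only [Pi.neg_apply, hy i, neg_add, ← Finset.sum_neg_distrib]
  congr 1
  exact Finset.sum_congr rfl fun j _ => by ring

lemma le_of_forall_le (h : IsSymmAveraging w x y) {C : ℝ} (hC : ∀ i, x i ≤ C) (i : Fin n) :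
    y i ≤ C := by
  obtain ⟨h0, -, h1, hy⟩ := h
  have hsum : ∑ j, w i j * (x j - x i) ≤ (∑ j, w i j) * (C - x i) := by
    rw [Finset.sum_mul]
    exact Finset.sum_le_sum fun j _ =>
      mul_le_mul_of_nonneg_left (by linarith [hC j]) (h0 i j)
  rw [hy i]
  nlinarith [h1 i, hC i]

lemma sum_antisymm (hs : ∀ i j, w i j = w j i) (f : Fin n → ℝ) :
    ∑ i, ∑ j, w i j * (f j - f i) = 0 := by
  have h : ∑ i, ∑ j, w i j * (f j - f i) = -∑ i, ∑ j, w i j * (f j - f i) := by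
    conv_lhs => rw [Finset.sum_comm]
    simp only [← Finset.sum_neg_distrib]
    exact Finset.sum_congr rfl fun i _ => Finset.sum_congr rfl fun j _ => by
      rw [hs j i]; ring
  linarith

lemma sum_eq (h : IsSymmAveraging w x y) : ∑ i, y i = ∑ i, x i := by
  obtain ⟨-, hs, -, hy⟩ := h
  simp only [hy, Finset.sum_add_distrib, sum_antisymm hs x, add_zero]

lemma sum_sub_sq_le (h : IsSymmAveraging w x y) (c : ℝ) :
    ∑ i, (y i - c) ^ 2 ≤ ∑ i, (x i - c) ^ 2 := by
  obtain ⟨h0, hs, h1, hy⟩ := h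
  have key : ∀ i, (y i - c) ^ 2 ≤
      (x i - c) ^ 2 + ∑ j, w i j * ((x j - c) ^ 2 - (x i - c) ^ 2) := by
    intro i
    have hcs : (∑ j, w i j * (x j - x i)) ^ 2 ≤
        (∑ j, w i j) * ∑ j, w i j * (x j - x i) ^ 2 :=
      Finset.sum_sq_le_sum_mul_sum_of_sq_le_mul _ (fun j _ => h0 i j)
        (fun j _ => mul_nonneg (h0 i j) (sq_nonneg _)) (fun j _ => le_of_eq (by ring))
    have hnn : 0 ≤ ∑ j, w i j * (x j - x i) ^ 2 :=
      Finset.sum_nonneg fun j _ => mul_nonneg (h0 i j) (sq_nonneg _)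
    have hexp : ∑ j, w i j * ((x j - c) ^ 2 - (x i - c) ^ 2) =
        ∑ j, w i j * (x j - x i) ^ 2 + 2 * (x i - c) * ∑ j, w i j * (x j - x i) := by
      rw [Finset.mul_sum, ← Finset.sum_add_distrib]
      exact Finset.sum_congr rfl fun j _ => by ring
    rw [hexp, hy i]
    nlinarith [h1 i]
  calc ∑ i, (y i - c) ^ 2
      ≤ ∑ i, ((x i - c) ^ 2 + ∑ j, w i j * ((x j - c) ^ 2 - (x i - c) ^ 2)) :=
        Finset.sum_le_sum fun i _ => key i
    _ = ∑ i, (x i - c) ^ 2 := by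
        rw [Finset.sum_add_distrib, sum_antisymm hs fun i => (x i - c) ^ 2, add_zero]

lemma maxV_le [Nonempty (Fin n)] (h : IsSymmAveraging w x y) : maxV y ≤ maxV x :=
  ciSup_le (h.le_of_forall_le fun i => le_ciSup (Set.finite_range x).bddAbove i)

lemma le_minV [Nonempty (Fin n)] (h : IsSymmAveraging w x y) : minV x ≤ minV y :=
  le_ciInf fun i => neg_le_neg_iff.1 <|
    h.neg.le_of_forall_le (fun j => neg_le_neg (ciInf_le (Set.finite_range x).bddBelow j)) i

lemma V2_le (h : IsSymmAveraging w x y) : V2 y ≤ V2 x := by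
  unfold V2
  rw [h.sum_eq]
  exact Real.sqrt_le_sqrt (h.sum_sub_sq_le _)

end IsSymmAveraging

lemma abs_le_one_of_Rq_eq_zero {y : ℝ} (h : Rq y = 0) : |y| ≤ 1 := by
  unfold Rq at h
  split_ifs at h <;> exact abs_le.2 ⟨by linarith, by linarith⟩

/-- If `c` approximates `d` with an error below `|c| / 2`, then `0 ≤ c / d ≤ 2`. -/
lemma div_mem_Icc_of_abs_sub_lt {c d : ℝ} (h : |d - c| < |c| / 2) :
    d ≠ 0 ∧ 0 ≤ c / d ∧ c / d ≤ 2 := by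
  rcases abs_cases c with ⟨hc, -⟩ | ⟨hc, -⟩ <;> rw [hc, abs_lt] at h <;> obtain ⟨h1, h2⟩ := h
  · have hd : 0 < d := by linarith
    exact ⟨hd.ne', div_nonneg (by linarith) hd.le, (div_le_iff₀ hd).2 (by linarith)⟩
  · have hd : d < 0 := by linarith
    exact ⟨hd.ne, div_nonneg_of_nonpos (by linarith) hd.le,
      (div_le_iff_of_neg hd).2 (by linarith)⟩

namespace Protocol

variable {n : ℕ} (P : Protocol n)

lemma xin_eq_xout (t : ℕ) (i j : Fin n) : P.xin t i j = P.xout t j i := by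
  induction t with
  | zero => rw [P.hxin0, P.hxout0]
  | succ t ih =>
    by_cases h : P.E (t + 1) i j
    · rw [P.hxinE _ (by omega) _ _ h, P.hxoutE _ (by omega) _ _ (P.Esymm _ _ _ h)]
      simpa using ih
    · rw [P.hxinN _ (by omega) _ _ h, P.hxoutN _ (by omega) _ _ fun h' => h (P.Esymm _ _ _ h')]
      simpa using ih

lemma mem_S {t : ℕ} {i j : Fin n} : j ∈ P.S t i ↔ P.E t i j ∧
    4 / (t : ℝ) ^ P.α < |P.xin t i j - P.xout t i j| ∧ P.q t j i = 0 ∧ P.q t i j = 0 := by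
  simp [S]

lemma mem_S_comm {t : ℕ} {i j : Fin n} : j ∈ P.S t i ↔ i ∈ P.S t j := by
  have : ∀ {i j}, j ∈ P.S t i → i ∈ P.S t j := by
    intro i j h
    rw [mem_S, xin_eq_xout] at h
    rw [mem_S, xin_eq_xout, abs_sub_comm]
    exact ⟨P.Esymm _ _ _ h.1, h.2.1, h.2.2.2, h.2.2.1⟩
  exact ⟨this, this⟩

lemma abs_sub_xout_le {t : ℕ} {i j : Fin n} (hE : P.E (t + 1) i j) (hq : P.q (t + 1) i j = 0) :
    |P.x t i - P.xout (t + 1) i j| ≤ 1 / ((t + 1 : ℕ) : ℝ) ^ P.α := by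
  have hpos : 0 < ((t + 1 : ℕ) : ℝ) ^ P.α := Real.rpow_pos_of_pos (by positivity) _
  have h := P.hq (t + 1) (by omega) i j hE
  rw [hq, Nat.add_sub_cancel] at h
  have h1 := abs_le_one_of_Rq_eq_zero h.symm
  rw [abs_mul, abs_of_pos hpos] at h1
  have hout := P.hxoutE (t + 1) (by omega) i j hE
  rw [hq, Nat.add_sub_cancel, zero_div, add_zero] at hout
  rwa [hout, le_div_iff₀ hpos, mul_comm]

lemma estimate_ratio {t : ℕ} {i j : Fin n} (h : j ∈ P.S (t + 1) i) :
    P.x t j - P.x t i ≠ 0 ∧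
      0 ≤ (P.xin (t + 1) i j - P.xout (t + 1) i j) / (P.x t j - P.x t i) ∧
      (P.xin (t + 1) i j - P.xout (t + 1) i j) / (P.x t j - P.x t i) ≤ 2 := by
  rw [mem_S] at h
  obtain ⟨hE, hlt, hji, hij⟩ := h
  apply div_mem_Icc_of_abs_sub_lt
  have h1 := P.abs_sub_xout_le hE hij
  have h2 := P.abs_sub_xout_le (P.Esymm _ _ _ hE) hji
  rw [← P.xin_eq_xout] at h2
  have h3 : P.x t j - P.x t i - (P.xin (t + 1) i j - P.xout (t + 1) i j) =
      (P.x t j - P.xin (t + 1) i j) - (P.x t i - P.xout (t + 1) i j) := by ring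
  rw [h3]
  have h4 := abs_sub (P.x t j - P.xin (t + 1) i j) (P.x t i - P.xout (t + 1) i j)
  have h5 : 4 / ((t + 1 : ℕ) : ℝ) ^ P.α = 4 * (1 / ((t + 1 : ℕ) : ℝ) ^ P.α) := by ring
  rw [h5] at hlt
  linarith

lemma card_S_le_D {t : ℕ} {i j : Fin n} (h : P.E t i j) : ((P.S t i).card : ℝ) ≤ P.D i j t := by
  refine le_trans ?_ (P.Dbound t i j h)
  rw [← Set.ncard_coe_finset]
  exact_mod_cast le_max_of_le_left
    (Set.ncard_le_ncard (fun k hk => (P.mem_S.1 hk).1) (Set.toFinite _))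

/-- The effective averaging weight of the edge `(i,j)` in the step from `t` to `t + 1`. -/
def weight (t : ℕ) (i j : Fin n) : ℝ :=
  if j ∈ P.S (t + 1) i then
    1 / ((t + 1 : ℕ) : ℝ) ^ P.β *
      ((P.xin (t + 1) i j - P.xout (t + 1) i j) / (P.x t j - P.x t i) / (4 * P.D i j (t + 1)))
  else 0

lemma weight_bounds (t : ℕ) {i j : Fin n} (h : j ∈ P.S (t + 1) i) :
    0 ≤ P.weight t i j ∧ P.weight t i j ≤ 1 / (P.S (t + 1) i).card := by
  obtain ⟨-, h0, h2⟩ := P.estimate_ratio h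
  have hcard : (0 : ℝ) < (P.S (t + 1) i).card := by
    exact_mod_cast Finset.card_pos.2 ⟨j, h⟩
  have hD := P.card_S_le_D (P.mem_S.1 h).1
  have hb : (1 : ℝ) ≤ ((t + 1 : ℕ) : ℝ) ^ P.β :=
    Real.one_le_rpow (by simp) (P.hα.trans P.hαβ).le
  have hb1 : 1 / ((t + 1 : ℕ) : ℝ) ^ P.β ≤ 1 := (div_le_one (by linarith)).2 hb
  have hb0 : 0 ≤ 1 / ((t + 1 : ℕ) : ℝ) ^ P.β := by positivity
  rw [weight, if_pos h]
  set r := (P.xin (t + 1) i j - P.xout (t + 1) i j) / (P.x t j - P.x t i)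
  have hr0 : 0 ≤ r / (4 * P.D i j (t + 1)) := div_nonneg h0 (by linarith)
  refine ⟨mul_nonneg hb0 hr0, (mul_le_of_le_one_left hr0 hb1).trans ?_⟩
  rw [div_le_div_iff₀ (by linarith) hcard]
  nlinarith

lemma isSymmAveraging_weight (t : ℕ) :
    IsSymmAveraging (P.weight t) (P.x t) (P.x (t + 1)) := by
  refine ⟨fun i j => ?_, fun i j => ?_, fun i => ?_, fun i => ?_⟩
  · by_cases h : j ∈ P.S (t + 1) i
    · exact (P.weight_bounds t h).1
    · rw [weight, if_neg h]
  · simp only [weight, P.mem_S_comm (i := i) (j := j), P.Dsymm i j, P.xin_eq_xout]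
    rw [← neg_sub (P.xout (t + 1) i j), ← neg_sub (P.x t i), neg_div_neg_eq]
  · have h : ∑ j, P.weight t i j = ∑ j ∈ P.S (t + 1) i, P.weight t i j :=
      (Finset.sum_subset (Finset.subset_univ _) fun j _ hj => if_neg hj).symm
    rw [h]
    refine (Finset.sum_le_sum fun j hj => (P.weight_bounds t hj).2).trans ?_
    rw [Finset.sum_const, nsmul_eq_mul, mul_one_div]
    exact div_self_le_one _
  · rw [P.hx (t + 1) (by omega), Nat.add_sub_cancel, Finset.mul_sum]
    congr 1
    refine Eq.trans ?_ (Finset.sum_subset (Finset.subset_univ (P.S (t + 1) i)) fun j _ hj => ?_)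
    · refine Finset.sum_congr rfl fun j hj => ?_
      change j ∈ P.S (t + 1) i at hj
      have hne := (P.estimate_ratio hj).1
      rw [weight, if_pos hj, mul_assoc, div_right_comm, div_mul_cancel₀ _ hne]
    · rw [weight, if_neg hj, zero_mul]

end Protocol

/-- `M(t)` is nonincreasing, `m(t)` is nondecreasing, and `V2(t)` is
nonincreasing. -/
theorem stmt6_lyapunov_monotone {n : ℕ} (hn : 1 ≤ n) (P : Protocol n) :
    Antitone (fun t => maxV (P.x t)) ∧ Monotone (fun t => minV (P.x t)) ∧
      Antitone (fun t => V2 (P.x t)) := by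
  have : Nonempty (Fin n) := ⟨⟨0, hn⟩⟩
  exact ⟨antitone_nat_of_succ_le fun t => (P.isSymmAveraging_weight t).maxV_le,
    monotone_nat_of_le_succ fun t => (P.isSymmAveraging_weight t).le_minV,
    antitone_nat_of_succ_le fun t => (P.isSymmAveraging_weight t).V2_le⟩
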